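/- For every f ∈ OPol_a, w_0(D_a(f)) = (−1)^{C(a,2)} D_a(w_0(f)), where C(a,2) = a(a−1)/2 and w_0 is the longest element of S_a acting via the signed permutation action. -/

import Mathlib

open scoped BigOperators

/-- The defining anticommutation relations of the odd polynomial ring. -/
inductive OddRel (a : ℕ) : FreeAlgebra ℤ (Fin a) → FreeAlgebra ℤ (Fin a) → Prop
  | anticomm (i j : Fin a) (h : i ≠ j) :
      OddRel a (FreeAlgebra.ι ℤ i * FreeAlgebra.ι ℤ j)
        (-(FreeAlgebra.ι ℤ j * FreeAlgebra.ι ℤ i))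

/-- The ring of odd polynomials in `a` variables over `ℤ`. -/
abbrev OPol (a : ℕ) : Type := RingQuot (OddRel a)

/-- The variable `x_{i+1}` (`0`-based index). -/
noncomputable def OX {a : ℕ} (i : Fin a) : OPol a :=
  RingQuot.mkRingHom (OddRel a) (FreeAlgebra.ι ℤ i)

/-- The variable `x_i` (`1`-based index), `0` if out of range. -/
noncomputable def xv (a : ℕ) (i : ℕ) : OPol a :=
  if h : 1 ≤ i ∧ i ≤ a then OX ⟨i - 1, by omega⟩ else 0

/-- The signed variable `x̃_i = (−1)^{i−1} x_i` (`0`-based index, so the sign is `(−1)^i`). -/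
noncomputable def xt (a : ℕ) (i : Fin a) : OPol a := (-1 : OPol a) ^ (i : ℕ) * OX i

/-- Odd elementary symmetric polynomial `ε_k`. -/
noncomputable def eps (a k : ℕ) : OPol a :=
  ∑ t ∈ Finset.powersetCard k (Finset.univ : Finset (Fin a)),
    ((t.sort (· ≤ ·)).map (xt a)).prod

/-- Odd complete symmetric polynomial `h_k`. -/
noncomputable def hp (a k : ℕ) : OPol a :=
  ∑ σ : Sym (Fin a) k, (((σ : Multiset (Fin a)).sort (· ≤ ·)).map (xt a)).prod

/-- The ordered monomial `x_1^{c_1} ⋯ x_a^{c_a}`. -/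
noncomputable def xmon {a : ℕ} (c : Fin a → ℕ) : OPol a :=
  ((List.finRange a).map fun i => OX i ^ c i).prod

/-- The staircase monomial `x^{δ_a} = x_1^{a−1} x_2^{a−2} ⋯ x_a^0`. -/
noncomputable def xdelta (a : ℕ) : OPol a :=
  ((List.finRange a).map fun i => OX i ^ (a - 1 - (i : ℕ))).prod

/-- Composite of the operators `d i` along a word, leftmost letter acting last (outermost). -/
noncomputable def dword {a : ℕ} (d : ℕ → OPol a →+ OPol a) : List ℕ → (OPol a →+ OPol a)
  | [] => AddMonoidHom.id _
  | i :: l => (d i).comp (dword d l)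

/-- The word `1, (2,1), (3,2,1), …, (a−1,…,2,1)` for the longest element, so that
`dword d (DList a) = ∂_1∘(∂_2∘∂_1)∘⋯∘(∂_{a−1}∘⋯∘∂_1) = D_a`. -/
def DList (a : ℕ) : List ℕ :=
  ((List.range a).map fun b => (List.range b).reverse.map (· + 1)).flatten

/-- Left multiplication by `f` as a `ℤ`-linear endomorphism. -/
noncomputable def mulL {a : ℕ} (f : OPol a) : Module.End ℤ (OPol a) :=
  (AddMonoidHom.mulLeft f).toIntLinearMap

/-- The generators of the odd nilHecke ring inside `End_ℤ(OPol a)`. -/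
noncomputable def onhGens (a : ℕ) (d : ℕ → OPol a →+ OPol a) :
    Set (Module.End ℤ (OPol a)) :=
  {T | (∃ i : Fin a, T = mulL (OX i)) ∨
    (∃ i : ℕ, 1 ≤ i ∧ i + 1 ≤ a ∧ T = (d i).toIntLinearMap)}

/-- The simple transposition `s_i` (`1`-based) of `{1,…,a}`. -/
def sperm (a : ℕ) (i : ℕ) : Equiv.Perm (Fin a) :=
  if h : 1 ≤ i ∧ i + 1 ≤ a then Equiv.swap ⟨i - 1, by omega⟩ ⟨i, by omega⟩ else 1

/-- The permutation associated to a word in the simple transpositions. -/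
def wordPerm (a : ℕ) (l : List ℕ) : Equiv.Perm (Fin a) := (l.map (sperm a)).prod

/-- Evaluation of an (even) multivariate polynomial at the squared variables `x_1², …, x_a²`. -/
noncomputable def sqEval {a : ℕ} (p : MvPolynomial (Fin a) ℤ) : OPol a :=
  ∑ m ∈ p.support,
    MvPolynomial.coeff m p • ((List.finRange a).map fun i => OX i ^ (2 * m i)).prod

/-- The odd symmetrization operator `S(f) = (−1)^{C(a,3)} w₀(D_a(f·x^{δ_a}))`. -/
noncomputable def oddSymzn (a : ℕ) (d : ℕ → OPol a →+ OPol a) (W0 : OPol a →+* OPol a)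
    (f : OPol a) : OPol a :=
  (-1 : OPol a) ^ Nat.choose a 3 * W0 (dword d (DList a) (f * xdelta a))

/-- The odd Schur polynomial `s_α = (−1)^{C(a,3)} w₀(D_a(x^α·x^{δ_a}))`. -/
noncomputable def schurP (a : ℕ) (d : ℕ → OPol a →+ OPol a) (W0 : OPol a →+* OPol a)
    (α : Fin a → ℕ) : OPol a :=
  (-1 : OPol a) ^ Nat.choose a 3 * W0 (dword d (DList a) (xmon α * xdelta a))

/-- The 0-Hecke generator `∂̄_r = x_r ∘ ∂_r`. -/
noncomputable def dbar (a : ℕ) (d : ℕ → OPol a →+ OPol a) (r : ℕ) : OPol a →+ OPol a :=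
  (AddMonoidHom.mulLeft (xv a r)).comp (d r)

/-- The `ℤ`-span of products of exactly `n` variables: the degree-`2n` component of `OPol a`. -/
def degComp (a n : ℕ) : Submodule ℤ (OPol a) :=
  Submodule.span ℤ {f : OPol a | ∃ l : List (Fin a), l.length = n ∧ f = (l.map OX).prod}

/-- Odd Schubert polynomial `𝔰_w = ∂_{w⁻¹w₀}(x^{δ_a})` for a fixed choice `red` of
reduced expressions. -/
noncomputable def schubert (a : ℕ) (d : ℕ → OPol a →+ OPol a)
    (red : Equiv.Perm (Fin a) → List ℕ) (w : Equiv.Perm (Fin a)) : OPol a :=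
  dword d (red (w⁻¹ * Fin.revPerm)) (xdelta a)

/-- Product of odd elementary symmetric polynomials along the parts of a partition,
in non-increasing order. -/
noncomputable def epsPart (a : ℕ) {n : ℕ} (p : Nat.Partition n) : OPol a :=
  (((p.parts.sort (· ≤ ·)).reverse).map (eps a)).prod

/-- Ascending product `e_1 e_2 ⋯ e_n`. -/
def ascProd {R : Type*} [Ring R] (e : ℕ → R) : ℕ → R
  | 0 => 1
  | n + 1 => ascProd e n * e (n + 1)

/-- Descending product `e_n ⋯ e_2 e_1`. -/
def descProd {R : Type*} [Ring R] (e : ℕ → R) : ℕ → R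
  | 0 => 1
  | n + 1 => e (n + 1) * descProd e n

/-- The product of `e` along the word `DList n`. -/
def longProd {R : Type*} [Ring R] (e : ℕ → R) : ℕ → R
  | 0 => 1
  | n + 1 => longProd e n * descProd e n

section Words

variable {R : Type*} [Ring R]

theorem ascProd_succ' (e : ℕ → R) (n : ℕ) :
    ascProd e (n + 1) = e 1 * ascProd (fun i => e (i + 1)) n := by
  induction n with
  | zero => simp [ascProd]
  | succ n ih => rw [ascProd, ih, ascProd, mul_assoc]

theorem descProd_succ' (e : ℕ → R) (n : ℕ) :
    descProd e (n + 1) = descProd (fun i => e (i + 1)) n * e 1 := by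
  induction n with
  | zero => simp [descProd]
  | succ n ih => rw [descProd, ih, descProd, mul_assoc]

theorem descProd_congr {e e' : ℕ → R} {n : ℕ} (h : ∀ i, 1 ≤ i → i ≤ n → e i = e' i) :
    descProd e n = descProd e' n := by
  induction n with
  | zero => rfl
  | succ n ih =>
    rw [descProd, descProd, h (n + 1) (by omega) le_rfl, ih fun i h1 h2 => h i h1 (by omega)]

theorem longProd_congr {e e' : ℕ → R} {n : ℕ} (h : ∀ i, 1 ≤ i → i < n → e i = e' i) :
    longProd e n = longProd e' n := by
  induction n with
  | zero => rfl
  | succ n ih =>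
    rw [longProd, longProd, ih fun i h1 h2 => h i h1 (by omega),
      descProd_congr fun i h1 h2 => h i h1 (by omega)]

theorem descProd_reflect (e : ℕ → R) (n : ℕ) :
    descProd (fun i => e (n + 1 - i)) n = ascProd e n := by
  induction n generalizing e with
  | zero => rfl
  | succ n ih =>
    rw [ascProd_succ', ← ih, descProd]
    congr 1
    · simp
    · refine descProd_congr fun i _ h2 => ?_
      congr 1
      omega

/-- An element anticommuting with all letters of `ascProd` and `descProd` can be moved from both
sides to the middle without a sign. -/
theorem mul_descProd_mul_ascProd_mul {e : ℕ → R} {y : R}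
    (h : ∀ i, 1 ≤ i → y * e i = -(e i * y)) (n : ℕ) (z : R) :
    y * (descProd e n * z * ascProd e n) * y = descProd e n * (y * z * y) * ascProd e n := by
  induction n generalizing z with
  | zero => simp [descProd, ascProd]
  | succ n ih =>
    have hy := h (n + 1) (by omega)
    have hy' : e (n + 1) * y = -(y * e (n + 1)) := by rw [hy, neg_neg]
    calc y * (descProd e (n + 1) * z * ascProd e (n + 1)) * y
        = (y * e (n + 1)) * (descProd e n * z * ascProd e n) * (e (n + 1) * y) := by
          simp only [descProd, ascProd, mul_assoc]
      _ = -(e (n + 1) * y) * (descProd e n * z * ascProd e n) * -(y * e (n + 1)) :=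
          congrArg₂ (fun u v => u * _ * v) hy hy'
      _ = e (n + 1) * (y * (descProd e n * z * ascProd e n) * y) * e (n + 1) := by
          simp only [mul_assoc, neg_mul, mul_neg, neg_neg]
      _ = descProd e (n + 1) * (y * z * y) * ascProd e (n + 1) := by
          rw [ih]
          simp only [descProd, ascProd, mul_assoc]

/-- `e_1 ⋯ e_{n+1} ⋯ e_1 = e_{n+1} ⋯ e_1 ⋯ e_{n+1}` under the odd braid relations. -/
theorem ascProd_mul_descProd {e : ℕ → R}
    (hc : ∀ i j, i + 2 ≤ j → e i * e j = -(e j * e i))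
    (hb : ∀ i, e i * e (i + 1) * e i = e (i + 1) * e i * e (i + 1)) (n : ℕ) :
    ascProd e (n + 1) * descProd e n =
      descProd e (n + 1) * ascProd (fun i => e (i + 1)) n := by
  induction n generalizing e with
  | zero => simp [descProd, ascProd]
  | succ n ih =>
    have key := ih (e := fun i => e (i + 1)) (fun i j h => hc _ _ (by omega)) (fun i => hb _)
    rw [descProd_succ'] at key
    calc ascProd e (n + 1 + 1) * descProd e (n + 1)
        = e 1 * (ascProd (fun i => e (i + 1)) (n + 1) * descProd (fun i => e (i + 1)) n)
            * e 1 := by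
          rw [ascProd_succ', descProd_succ']
          simp only [mul_assoc]
      _ = descProd (fun i => e (i + 1 + 1)) n * (e 1 * e (1 + 1) * e 1)
            * ascProd (fun i => e (i + 1 + 1)) n := by
          rw [key]
          exact mul_descProd_mul_ascProd_mul (e := fun i => e (i + 1 + 1))
            (fun i h => hc _ _ (by omega)) n _
      _ = descProd e (n + 1 + 1) * ascProd (fun i => e (i + 1)) (n + 1) := by
          rw [hb 1, descProd_succ' e, descProd_succ' (fun i => e (i + 1)),
            ascProd_succ' (fun i => e (i + 1))]
          simp only [mul_assoc]

theorem longProd_succ_eq_shift {e : ℕ → R}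
    (hc : ∀ i j, i + 2 ≤ j → e i * e j = -(e j * e i))
    (hb : ∀ i, e i * e (i + 1) * e i = e (i + 1) * e i * e (i + 1)) (n : ℕ) :
    longProd e (n + 1) = longProd (fun i => e (i + 1)) n * ascProd e n := by
  induction n with
  | zero => simp [longProd, descProd, ascProd]
  | succ n ih =>
    calc longProd e (n + 1 + 1)
        = longProd (fun i => e (i + 1)) n * (ascProd e (n + 1) * descProd e n) := by
          rw [longProd, ih, descProd, ascProd]
          simp only [mul_assoc]
      _ = longProd (fun i => e (i + 1)) (n + 1) * ascProd e (n + 1) := by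
          rw [ascProd_mul_descProd hc hb, longProd, descProd_succ', ascProd_succ']
          simp only [mul_assoc]

/-- Under the odd braid relations, the product along the longest word is invariant under the
diagram automorphism `i ↦ n - i`. -/
theorem longProd_reflect {e : ℕ → R}
    (hc : ∀ i j, i + 2 ≤ j → e i * e j = -(e j * e i))
    (hb : ∀ i, e i * e (i + 1) * e i = e (i + 1) * e i * e (i + 1)) (n : ℕ) :
    longProd (fun i => e (n - i)) n = longProd e n := by
  induction n generalizing e with
  | zero => rfl
  | succ n ih =>
    rw [longProd_succ_eq_shift hc hb, longProd, descProd_reflect,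
      ← ih (fun i j h => hc _ _ (by omega)) (fun i => hb _)]
    congr 1
    refine longProd_congr fun i _ h2 => ?_
    congr 1
    omega

theorem DList_succ (n : ℕ) : DList (n + 1) = DList n ++ (List.range n).reverse.map (· + 1) := by
  simp [DList, List.range_succ]

theorem prod_map_DList (e : ℕ → R) (n : ℕ) : ((DList n).map e).prod = longProd e n := by
  have hdesc (n : ℕ) :
      (((List.range n).reverse.map (· + 1)).map e).prod = descProd e n := by
    induction n with
    | zero => rfl
    | succ n ih =>
      rw [descProd, ← ih]
      simp [List.range_succ]
  induction n with
  | zero => rfl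
  | succ n ih => rw [DList_succ, List.map_append, List.prod_append, ih, hdesc, longProd]

theorem length_DList (n : ℕ) : (DList n).length = n.choose 2 := by
  induction n with
  | zero => rfl
  | succ n ih =>
    rw [DList_succ, List.length_append, ih, Nat.choose_succ_succ' n 1]
    simp [add_comm]

theorem mem_DList {n i : ℕ} (h : i ∈ DList n) : 1 ≤ i ∧ i + 1 ≤ n := by
  simp only [DList, List.mem_flatten, List.mem_map, List.mem_range] at h
  obtain ⟨_, ⟨b, hb, rfl⟩, hi⟩ := h
  simp only [List.mem_map, List.mem_reverse, List.mem_range] at hi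
  omega

end Words

theorem OX_eq_xv {a : ℕ} (i : Fin a) : OX i = xv a (i + 1) := by
  have h : 1 ≤ (i : ℕ) + 1 ∧ (i : ℕ) + 1 ≤ a := by omega
  simp [xv, h]

theorem xv_eq_zero {a j : ℕ} (h : ¬(1 ≤ j ∧ j ≤ a)) : xv a j = 0 := dif_neg h

theorem closure_range_xv (a : ℕ) : Subring.closure (Set.range (xv a)) = ⊤ := by
  refine eq_top_iff.2 fun f _ => ?_
  obtain ⟨f, rfl⟩ := RingQuot.mkRingHom_surjective (OddRel a) f
  induction f with
  | grade0 n =>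
    rw [eq_intCast, map_intCast]
    exact intCast_mem _ n
  | grade1 i => exact Subring.subset_closure ⟨i + 1, (OX_eq_xv i).symm⟩
  | mul f g hf hg => rw [map_mul]; exact mul_mem (hf trivial) (hg trivial)
  | add f g hf hg => rw [map_add]; exact add_mem (hf trivial) (hg trivial)

/-- In a ring generated by `x`, the maps `s` and `d` are the signed transposition and the odd
divided difference of index `i`. -/
structure IsOddDividedDifference {A : Type*} [Ring A] (x : ℕ → A) (i : ℕ) (s : A →+* A)
    (d : A →+ A) : Prop where
  closure_eq_top : Subring.closure (Set.range x) = ⊤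
  s_x : ∀ j, s (x j) = if j = i then -x (i + 1) else if j = i + 1 then -x i else -x j
  d_one : d 1 = 0
  d_x : ∀ j, d (x j) = if j = i ∨ j = i + 1 then 1 else 0
  leibniz : ∀ f g, d (f * g) = d f * g + s f * d g

theorem ring_induction_of_closure {A : Type*} [Ring A] {x : ℕ → A}
    (hx : Subring.closure (Set.range x) = ⊤) {P : A → Prop} (var : ∀ j, P (x j))
    (one : P 1) (add : ∀ f g, P f → P g → P (f + g)) (neg : ∀ f, P f → P (-f))
    (mul : ∀ f g, P f → P g → P (f * g)) (f : A) : P f := by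
  have hf : f ∈ Subring.closure (Set.range x) := hx ▸ Subring.mem_top f
  induction hf using Subring.closure_induction with
  | mem f hf => obtain ⟨j, rfl⟩ := hf; exact var j
  | zero => simpa using add _ _ one (neg _ one)
  | one => exact one
  | add f g _ _ hf hg => exact add f g hf hg
  | neg f _ hf => exact neg f hf
  | mul f g _ _ hf hg => exact mul f g hf hg

namespace IsOddDividedDifference

variable {A : Type*} [Ring A] {x : ℕ → A} {i j : ℕ} {s t : A →+* A} {d e : A →+ A}

theorem d_s (hi : IsOddDividedDifference x i s d) (f : A) : d (s f) = -s (d f) := by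
  induction f using ring_induction_of_closure hi.closure_eq_top with
  | var k =>
    obtain rfl | rfl | h : k = i ∨ k = i + 1 ∨ (k ≠ i ∧ k ≠ i + 1) := by omega
    all_goals simp [hi.s_x, hi.d_x, *]
  | one => simp [hi.d_one]
  | add f g hf hg => simp only [map_add, hf, hg, neg_add]
  | neg f hf => simp only [map_neg, hf]
  | mul f g hf hg =>
    simp only [map_mul, map_add, hi.leibniz, hf, hg, neg_mul, mul_neg, neg_add]

theorem d_d (hi : IsOddDividedDifference x i s d) (f : A) : d (d f) = 0 := by
  induction f using ring_induction_of_closure hi.closure_eq_top with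
  | var k =>
    rw [hi.d_x]
    split_ifs <;> simp [hi.d_one]
  | one => simp [hi.d_one]
  | add f g hf hg => simp only [map_add, hf, hg, add_zero]
  | neg f hf => simp only [map_neg, hf, neg_zero]
  | mul f g hf hg => simp [hi.leibniz, hi.d_s, hf, hg]

section Far

variable (hi : IsOddDividedDifference x i s d) (hj : IsOddDividedDifference x j t e)
  (hij : i + 2 ≤ j ∨ j + 2 ≤ i)

include hi hj hij

theorem s_t_of_far (f : A) : s (t f) = t (s f) := by
  induction f using ring_induction_of_closure hi.closure_eq_top with
  | var k =>
    obtain ⟨h1, h2, h3, h4, h5, h6⟩ : i ≠ j ∧ j ≠ i ∧ i ≠ j + 1 ∧ j ≠ i + 1 ∧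
      i + 1 ≠ j ∧ j + 1 ≠ i := by omega
    obtain rfl | rfl | rfl | rfl | h : k = i ∨ k = i + 1 ∨ k = j ∨ k = j + 1 ∨
      (k ≠ i ∧ k ≠ i + 1 ∧ k ≠ j ∧ k ≠ j + 1) := by omega
    all_goals simp [hi.s_x, hj.s_x, *]
  | one => simp
  | add f g hf hg => simp only [map_add, hf, hg]
  | neg f hf => simp only [map_neg, hf]
  | mul f g hf hg => simp only [map_mul, hf, hg]

theorem d_t_of_far (f : A) : d (t f) = -t (d f) := by
  induction f using ring_induction_of_closure hi.closure_eq_top with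
  | var k =>
    simp only [hi.d_x, hj.s_x, map_neg, apply_ite d, apply_ite t, map_one, map_zero]
    split_ifs <;> first | omega | simp
  | one => simp [hi.d_one]
  | add f g hf hg => simp only [map_add, hf, hg, neg_add]
  | neg f hf => simp only [map_neg, hf]
  | mul f g hf hg =>
    simp only [map_mul, map_add, hi.leibniz, hf, hg, s_t_of_far hi hj hij, neg_mul, mul_neg,
      neg_add]

theorem d_e_of_far (f : A) : d (e f) = -e (d f) := by
  induction f using ring_induction_of_closure hi.closure_eq_top with
  | var k =>
    rw [hi.d_x, hj.d_x]
    split_ifs <;> simp [hi.d_one, hj.d_one]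
  | one => simp [hi.d_one, hj.d_one]
  | add f g hf hg => simp only [map_add, hf, hg, neg_add]
  | neg f hf => simp only [map_neg, hf]
  | mul f g hf hg =>
    simp only [map_add, hi.leibniz, hj.leibniz, hf, hg, s_t_of_far hi hj hij,
      d_t_of_far hi hj hij, d_t_of_far hj hi hij.symm, neg_mul, mul_neg]
    abel

end Far

section Adjacent

variable (hi : IsOddDividedDifference x i s d) (hj : IsOddDividedDifference x j t e)
  (hij : j = i + 1 ∨ i = j + 1)

include hi hj hij

theorem s_t_s (f : A) : s (t (s f)) = t (s (t f)) := by
  induction f using ring_induction_of_closure hi.closure_eq_top with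
  | var k =>
    obtain rfl | rfl := hij
    · obtain ⟨h1, h2⟩ : i ≠ i + 1 + 1 ∧ i + 1 + 1 ≠ i := by omega
      obtain rfl | rfl | rfl | h : k = i ∨ k = i + 1 ∨ k = i + 1 + 1 ∨
        (k ≠ i ∧ k ≠ i + 1 ∧ k ≠ i + 1 + 1) := by omega
      all_goals simp [hi.s_x, hj.s_x, *]
    · obtain ⟨h1, h2⟩ : j ≠ j + 1 + 1 ∧ j + 1 + 1 ≠ j := by omega
      obtain rfl | rfl | rfl | h : k = j ∨ k = j + 1 ∨ k = j + 1 + 1 ∨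
        (k ≠ j ∧ k ≠ j + 1 ∧ k ≠ j + 1 + 1) := by omega
      all_goals simp [hi.s_x, hj.s_x, *]
  | one => simp
  | add f g hf hg => simp only [map_add, hf, hg]
  | neg f hf => simp only [map_neg, hf]
  | mul f g hf hg => simp only [map_mul, hf, hg]

theorem d_t_s (f : A) : d (t (s f)) = t (s (e f)) := by
  induction f using ring_induction_of_closure hi.closure_eq_top with
  | var k =>
    simp only [hi.s_x, hi.d_x, hj.s_x, hj.d_x, map_neg, apply_ite d, apply_ite s,
      apply_ite t, map_one, map_zero]
    obtain rfl | rfl := hij <;> split_ifs <;> first | omega | (simp; done) | simp_all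
  | one => simp [hi.d_one, hj.d_one]
  | add f g hf hg => simp only [map_add, hf, hg]
  | neg f hf => simp only [map_neg, hf]
  | mul f g hf hg =>
    simp only [map_mul, map_add, hi.leibniz, hj.leibniz, hf, hg, s_t_s hi hj hij]

theorem d_e_s (f : A) : d (e (s f)) = e (s (e f)) - s (e (d f)) := by
  induction f using ring_induction_of_closure hi.closure_eq_top with
  | var k =>
    simp only [hi.s_x, hi.d_x, hj.d_x, map_neg, apply_ite d, apply_ite e, apply_ite s,
      map_one, map_zero, hi.d_one, hj.d_one]
    split_ifs <;> simp
  | one => simp [hi.d_one, hj.d_one]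
  | add f g hf hg => simp only [map_add, hf, hg]; abel
  | neg f hf => simp only [map_neg, hf]; abel
  | mul f g hf hg =>
    simp only [map_mul, map_add, hi.leibniz, hj.leibniz, hf, hg, d_t_s hi hj hij,
      d_t_s hj hi hij.symm, hi.d_s, s_t_s hi hj hij, mul_neg, sub_mul, mul_sub]
    abel

theorem d_e_d (f : A) : d (e (d f)) = e (d (e f)) := by
  induction f using ring_induction_of_closure hi.closure_eq_top with
  | var k =>
    rw [hi.d_x, hj.d_x]
    split_ifs <;> simp [hi.d_one, hj.d_one]
  | one => simp [hi.d_one, hj.d_one]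
  | add f g hf hg => simp only [map_add, hf, hg]
  | neg f hf => simp only [map_neg, hf]
  | mul f g hf hg =>
    simp only [map_add, hi.leibniz, hj.leibniz, hf, hg, d_t_s hi hj hij, d_t_s hj hi hij.symm,
      d_e_s hi hj hij, d_e_s hj hi hij.symm, s_t_s hi hj hij, hi.d_d, hj.d_d, mul_zero, sub_mul]
    abel

end Adjacent

section Reflection

variable {a : ℕ} {c : A} {W : A →+* A} (hi : IsOddDividedDifference x i s d)
  (hj : IsOddDividedDifference x j t e) (hi0 : 1 ≤ i) (hj0 : 1 ≤ j) (hij : i + j = a)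
  (hc : c = 1 ∨ c = -1) (hW : ∀ k, W (x k) = c * x (a + 1 - k))

include hi hj hi0 hj0 hij hc hW

theorem map_s_reflect (f : A) : W (s f) = t (W f) := by
  induction f using ring_induction_of_closure hi.closure_eq_top with
  | var k =>
    rw [hW, hi.s_x, map_mul, hj.s_x]
    have htc : t c = c := by obtain rfl | rfl := hc <;> simp
    rw [htc]
    obtain rfl | rfl | h : k = i ∨ k = i + 1 ∨ (k ≠ i ∧ k ≠ i + 1) := by omega
    · rw [if_pos rfl, if_neg (by omega), if_pos (by omega), map_neg, hW, mul_neg]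
      congr 3
      omega
    · rw [if_neg (by omega), if_pos rfl, if_pos (by omega), map_neg, hW, mul_neg]
      congr 3
      omega
    · rw [if_neg h.1, if_neg h.2, if_neg (by omega), if_neg (by omega), map_neg, hW, mul_neg]
  | one => simp
  | add f g hf hg => simp only [map_add, hf, hg]
  | neg f hf => simp only [map_neg, hf]
  | mul f g hf hg => simp only [map_mul, hf, hg]

theorem map_d_reflect (f : A) : W (d f) = c * e (W f) := by
  have hs := map_s_reflect hi hj hi0 hj0 hij hc hW
  induction f using ring_induction_of_closure hi.closure_eq_top with
  | var k =>
    rw [hW, hi.d_x]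
    have hec : c * e (c * x (a + 1 - k)) = e (x (a + 1 - k)) := by
      obtain rfl | rfl := hc <;> simp
    rw [hec, hj.d_x, apply_ite W, map_one, map_zero]
    congr 1
    apply propext
    omega
  | one => simp [hi.d_one, hj.d_one]
  | add f g hf hg => simp only [map_add, hf, hg, mul_add]
  | neg f hf => simp only [map_neg, hf, mul_neg]
  | mul f g hf hg =>
    simp only [map_mul, map_add, hi.leibniz, hj.leibniz, hf, hg, hs, mul_add, mul_assoc]
    obtain rfl | rfl := hc <;> simp

end Reflection

end IsOddDividedDifference

section LongestWord

variable {A : Type*} [Ring A]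

theorem longProd_reflect_of_isOddDividedDifference {x : ℕ → A} {a : ℕ} {s : ℕ → A →+* A}
    {d : ℕ → AddMonoid.End A}
    (h : ∀ i, 1 ≤ i → i + 1 ≤ a → IsOddDividedDifference x i (s i) (d i)) :
    longProd (fun i => d (a - i)) a = longProd d a := by
  let e : ℕ → AddMonoid.End A := fun i => if 1 ≤ i ∧ i + 1 ≤ a then d i else 0
  have he {i : ℕ} (h1 : 1 ≤ i) (h2 : i + 1 ≤ a) : e i = d i := if_pos ⟨h1, h2⟩
  have he0 {i : ℕ} (hi : ¬(1 ≤ i ∧ i + 1 ≤ a)) : e i = 0 := if_neg hi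
  have hc (i j : ℕ) (hij : i + 2 ≤ j) : e i * e j = -(e j * e i) := by
    by_cases hi : 1 ≤ i ∧ i + 1 ≤ a
    · by_cases hj : 1 ≤ j ∧ j + 1 ≤ a
      · rw [he hi.1 hi.2, he hj.1 hj.2]
        ext f
        exact (h i hi.1 hi.2).d_e_of_far (h j hj.1 hj.2) (Or.inl hij) f
      · simp [he0 hj]
    · simp [he0 hi]
  have hb (i : ℕ) : e i * e (i + 1) * e i = e (i + 1) * e i * e (i + 1) := by
    by_cases hi : 1 ≤ i ∧ i + 1 ≤ a
    · by_cases hj : 1 ≤ i + 1 ∧ i + 1 + 1 ≤ a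
      · rw [he hi.1 hi.2, he hj.1 hj.2]
        ext f
        exact (h i hi.1 hi.2).d_e_d (h (i + 1) hj.1 hj.2) (Or.inl rfl) f
      · simp [he0 hj]
    · simp [he0 hi]
  rw [longProd_congr (e := d) (e' := e) fun i h1 h2 => (he h1 h2).symm, ← longProd_reflect hc hb]
  exact longProd_congr fun i h1 h2 => (he (by omega) (by omega)).symm

theorem map_prod_map_apply {W : A →+* A} {c : A} (hc : c = 1 ∨ c = -1)
    {d e : ℕ → AddMonoid.End A} (l : List ℕ) (h : ∀ i ∈ l, ∀ f, W (d i f) = c * e i (W f))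
    (f : A) : W ((l.map d).prod f) = c ^ l.length * (l.map e).prod (W f) := by
  induction l with
  | nil => simp
  | cons i l ih =>
    rw [List.map_cons, List.prod_cons, AddMonoid.End.coe_mul, Function.comp_apply, h i (by simp),
      ih fun j hj => h j (by simp [hj]), List.length_cons, pow_succ', List.map_cons,
      List.prod_cons, AddMonoid.End.coe_mul, Function.comp_apply]
    have hcl : c ^ l.length = 1 ∨ c ^ l.length = -1 := by
      obtain rfl | rfl := hc
      · simp
      · exact neg_one_pow_eq_or _ _
    obtain hcl | hcl := hcl <;> simp [hcl]

theorem map_prod_DList_apply {x : ℕ → A} {a : ℕ} {s : ℕ → A →+* A} {d : ℕ → AddMonoid.End A}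
    (h : ∀ i, 1 ≤ i → i + 1 ≤ a → IsOddDividedDifference x i (s i) (d i)) {W : A →+* A}
    (hW : ∀ k, W (x k) = (-1) ^ a.choose 2 * x (a + 1 - k)) (f : A) :
    W (((DList a).map d).prod f) = (-1) ^ a.choose 2 * ((DList a).map d).prod (W f) := by
  have hc : (-1 : A) ^ a.choose 2 = 1 ∨ (-1 : A) ^ a.choose 2 = -1 := neg_one_pow_eq_or _ _
  rw [map_prod_map_apply hc (e := fun i => d (a - i)) (DList a) (fun i hi => ?_) f, length_DList,
    prod_map_DList, prod_map_DList, longProd_reflect_of_isOddDividedDifference h]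
  · congr 1
    obtain h | h := Nat.even_or_odd (a.choose 2)
    · rw [h.neg_one_pow, one_pow]
    · rw [h.neg_one_pow, h.neg_one_pow]
  · obtain ⟨h1, h2⟩ := mem_DList hi
    exact (h i h1 h2).map_d_reflect (h (a - i) (by omega) (by omega)) h1 (by omega) (by omega)
      hc hW

end LongestWord

theorem dword_eq_prod {a : ℕ} (d : ℕ → OPol a →+ OPol a) (l : List ℕ) :
    dword d l = (List.map (β := AddMonoid.End (OPol a)) d l).prod := by
  induction l with
  | nil => rfl
  | cons i l ih =>
    rw [dword, ih]
    exact (List.prod_cons (α := AddMonoid.End (OPol a))).symm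

/-- w₀(D_a(f)) = (−1)^{C(a,2)} D_a(w₀(f)) for every f ∈ OPol_a. -/
theorem w0_Da_commutation (a : ℕ)
    (s : ℕ → OPol a →+* OPol a)
    (hs : ∀ i j : ℕ, 1 ≤ i → i + 1 ≤ a → 1 ≤ j → j ≤ a →
      s i (xv a j) =
        if j = i then -xv a (i + 1) else if j = i + 1 then -xv a i else -xv a j)
    (d : ℕ → OPol a →+ OPol a)
    (hd1 : ∀ i : ℕ, 1 ≤ i → i + 1 ≤ a → d i 1 = 0)
    (hdx : ∀ i j : ℕ, 1 ≤ i → i + 1 ≤ a → 1 ≤ j → j ≤ a →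
      d i (xv a j) = if j = i ∨ j = i + 1 then 1 else 0)
    (hdL : ∀ i : ℕ, 1 ≤ i → i + 1 ≤ a → ∀ f g : OPol a,
      d i (f * g) = d i f * g + s i f * d i g)
    (W0 : OPol a →+* OPol a)
    (hW0 : ∀ i : Fin a, W0 (OX i) = (-1 : OPol a) ^ Nat.choose a 2 * OX (Fin.rev i)) :
    ∀ f : OPol a,
      W0 (dword d (DList a) f) =
        (-1 : OPol a) ^ Nat.choose a 2 * dword d (DList a) (W0 f) := by
  have hd (i : ℕ) (h1 : 1 ≤ i) (h2 : i + 1 ≤ a) :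
      IsOddDividedDifference (xv a) i (s i) (d i) := by
    refine ⟨closure_range_xv a, fun j => ?_, hd1 i h1 h2, fun j => ?_, hdL i h1 h2⟩
    · by_cases hj : 1 ≤ j ∧ j ≤ a
      · exact hs i j h1 h2 hj.1 hj.2
      · rw [if_neg (by omega), if_neg (by omega), xv_eq_zero hj, map_zero]
        exact neg_zero.symm
    · by_cases hj : 1 ≤ j ∧ j ≤ a
      · exact hdx i j h1 h2 hj.1 hj.2
      · rw [if_neg (by omega), xv_eq_zero hj, map_zero]
  have hW (k : ℕ) : W0 (xv a k) = (-1 : OPol a) ^ Nat.choose a 2 * xv a (a + 1 - k) := by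
    by_cases hk : 1 ≤ k ∧ k ≤ a
    · have h := hW0 ⟨k - 1, by omega⟩
      rw [OX_eq_xv, OX_eq_xv, Fin.val_rev] at h
      convert h using 3 <;> simp only <;> omega
    · rw [xv_eq_zero hk, xv_eq_zero (by omega), map_zero, mul_zero]
  intro f
  rw [dword_eq_prod]
  exact map_prod_DList_apply hd hW f
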